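/- arXiv:2412.16387 — 3 statements merged into one kernel-verified Lean document; each statement's English description precedes it below -/
import Mathlib

section
/- Let 0 < c < 1 and 0 < a < 1 − c be constants, and set p_n = a·log n/n. Then for every constant c' with 0 < c' < c there is N such that for all n ≥ N, the probability that the Erdős–Rényi random graph G(n, p_n) is disconnected is at least 1 − n^{−c'}. -/
/-!
Erdős–Rényi random graphs `G(n,p)`: each of the `C(n,2)` unordered pairs of
distinct vertices is an edge independently with probability `p`.
-/

open scoped BigOperators

namespace ErdosRenyi

/-- Ordered pairs of distinct vertices `{(i,j) : i < j}`. -/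
abbrev EPair (n : ℕ) := {e : Fin n × Fin n // e.1 < e.2}

/-- A configuration records, for each pair, whether the edge is present. -/
abbrev EConfig (n : ℕ) := EPair n → Bool

/-- The probability of a given configuration in `G(n,p)`. -/
noncomputable def erWeight (n : ℕ) (p : ℝ) (ω : EConfig n) : ℝ :=
  ∏ e : EPair n, (if ω e then p else 1 - p)

/-- The probability of a set of configurations in `G(n,p)`. -/
noncomputable def erProb (n : ℕ) (p : ℝ) (S : Set (EConfig n)) : ℝ :=
  ∑ ω : EConfig n, S.indicator (erWeight n p) ω

/-- The simple graph determined by a configuration. -/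
def graphOf {n : ℕ} (ω : EConfig n) : SimpleGraph (Fin n) :=
  SimpleGraph.fromRel (fun i j => ∃ h : i < j, ω ⟨(i, j), h⟩ = true)

/-- The number of vertices of a largest connected component. -/
noncomputable def maxCompSize {n : ℕ} (H : SimpleGraph (Fin n)) : ℕ :=
  Finset.univ.sup (fun v => {w | H.Reachable v w}.ncard)

/-- indicator that all pairs in `A` are absent -/
noncomputable def absent {n : ℕ} (A : Finset (EPair n)) (ω : EConfig n) : ℝ :=
  ∏ e : EPair n, (if e ∈ A ∧ ω e = true then 0 else 1)

theorem absent_mul {n : ℕ} (A B : Finset (EPair n)) (ω : EConfig n) :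
    absent A ω * absent B ω = absent (A ∪ B) ω := by
  unfold absent
  rw [← Finset.prod_mul_distrib]
  refine Finset.prod_congr rfl fun e _ => ?_
  by_cases h1 : e ∈ A <;> by_cases h2 : e ∈ B <;> cases ω e <;> simp [h1, h2]

theorem exp_absent {n : ℕ} (p : ℝ) (A : Finset (EPair n)) :
    ∑ ω : EConfig n, erWeight n p ω * absent A ω = (1 - p) ^ A.card := by
  unfold erWeight absent
  simp_rw [← Finset.prod_mul_distrib]
  have h := Fintype.prod_sum (fun (e : EPair n) (b : Bool) =>
    (if b = true then p else 1 - p) * (if e ∈ A ∧ b = true then (0 : ℝ) else 1))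
  rw [← h]
  have h2 : ∀ e : EPair n, ∑ b : Bool,
      (if b = true then p else 1 - p) * (if e ∈ A ∧ b = true then (0 : ℝ) else 1)
      = if e ∈ A then 1 - p else 1 := by
    intro e
    by_cases he : e ∈ A <;> simp [he]
  rw [Finset.prod_congr rfl (fun e _ => h2 e)]
  rw [Finset.prod_ite_mem]
  simp

theorem exp_one {n : ℕ} (p : ℝ) : ∑ ω : EConfig n, erWeight n p ω = 1 := by
  have := exp_absent (n := n) p ∅
  simpa [absent] using this

theorem absent_ne_zero {n : ℕ} {A : Finset (EPair n)} {ω : EConfig n} (h : absent A ω ≠ 0) :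
    ∀ e ∈ A, ω e = false := by
  intro e he
  by_contra hw
  apply h
  unfold absent
  apply Finset.prod_eq_zero (Finset.mem_univ e)
  simp at hw
  simp [he, hw]

/-- pairs containing v -/
def star {n : ℕ} (v : Fin n) : Finset (EPair n) :=
  Finset.univ.filter (fun e => e.1.1 = v ∨ e.1.2 = v)

theorem star_card {n : ℕ} (v : Fin n) : (star v).card ≤ n := by
  have := Finset.card_le_card_of_injOn (s := star v) (t := (Finset.univ : Finset (Fin n)))
    (fun e => if e.1.1 = v then e.1.2 else e.1.1) (by intro e _; simp) (by
      rintro ⟨⟨x, y⟩, h⟩ hx ⟨⟨x', y'⟩, h'⟩ hx' hh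
      simp [star] at hx hx' hh h h' ⊢
      grind)
  simpa using this

theorem star_inter {n : ℕ} (v w : Fin n) (hvw : v ≠ w) : (star v ∩ star w).card ≤ 1 := by
  rw [Finset.card_le_one]
  rintro ⟨⟨x, y⟩, h⟩ hx ⟨⟨x', y'⟩, h'⟩ hx'
  simp [star] at hx hx' h h' ⊢
  grind

theorem not_conn {n : ℕ} (hn : 2 ≤ n) (ω : EConfig n) (v : Fin n) (h : absent (star v) ω ≠ 0) :
    ¬ (graphOf ω).Connected := by
  intro hc
  have : Nontrivial (Fin n) := Fin.nontrivial_iff_two_le.mpr hn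
  obtain ⟨w, hw⟩ := hc.preconnected.exists_adj_of_nontrivial v
  have h2 := absent_ne_zero h
  simp only [graphOf, SimpleGraph.fromRel_adj] at hw
  rcases hw.2 with ⟨hl, hh⟩ | ⟨hl, hh⟩
  · have := h2 ⟨(v, w), hl⟩ (by simp [star])
    simp [this] at hh
  · have := h2 ⟨(w, v), hl⟩ (by simp [star])
    simp [this] at hh

theorem weight_nonneg {n : ℕ} {p : ℝ} (h0 : 0 ≤ p) (h1 : p ≤ 1) (ω : EConfig n) :
    0 ≤ erWeight n p ω := by
  unfold erWeight
  refine Finset.prod_nonneg fun e _ => ?_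
  split_ifs <;> linarith

theorem cheb {n : ℕ} (hn : 2 ≤ n) (p : ℝ) (h0 : 0 ≤ p) (h1 : p < 1) :
    1 - (1 / (n * (1 - p) ^ n) + p / (1 - p)) ≤
      erProb n p {ω | ¬ (graphOf ω).Connected} := by
  set q := 1 - p with hq
  have hq0 : 0 < q := by linarith
  have hq1 : q ≤ 1 := by linarith
  set M : ℝ := ∑ v : Fin n, q ^ (star v).card with hM
  have hnpos : (0 : ℝ) < n := by exact_mod_cast (by omega : 0 < n)
  have hMn : n * q ^ n ≤ M := by
    have : ∑ v : Fin n, q ^ n ≤ M :=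
      Finset.sum_le_sum fun v _ => pow_le_pow_of_le_one hq0.le hq1 (star_card v)
    simpa using this
  have hnq : 0 < n * q ^ n := by positivity
  have hM0 : 0 < M := lt_of_lt_of_le hnq hMn
  let X : EConfig n → ℝ := fun ω => ∑ v : Fin n, absent (star v) ω
  have hE1 : ∑ ω, erWeight n p ω * X ω = M := by
    simp only [X, Finset.mul_sum]
    rw [Finset.sum_comm]
    exact Finset.sum_congr rfl fun v _ => exp_absent p _
  have hE2 : ∑ ω, erWeight n p ω * (X ω) ^ 2 ≤ M + M ^ 2 / q := by
    have e1 : ∑ ω, erWeight n p ω * (X ω) ^ 2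
        = ∑ v : Fin n, ∑ w : Fin n, q ^ (star v ∪ star w).card := by
      simp only [X, sq, Finset.sum_mul_sum, absent_mul]
      simp only [Finset.mul_sum]
      rw [Finset.sum_comm]
      refine Finset.sum_congr rfl fun v _ => ?_
      rw [Finset.sum_comm]
      exact Finset.sum_congr rfl fun w _ => exp_absent p _
    have e2 : M + M ^ 2 / q = ∑ v : Fin n, ∑ w : Fin n,
        ((if v = w then q ^ (star v).card else 0) + q ^ (star v).card * q ^ (star w).card / q) := by
      simp only [Finset.sum_add_distrib, Finset.sum_ite_eq, Finset.mem_univ, if_true,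
        ← Finset.sum_div, ← Finset.sum_mul_sum, sq, hM]
    rw [e1, e2]
    refine Finset.sum_le_sum fun v _ => Finset.sum_le_sum fun w _ => ?_
    by_cases hvw : v = w
    · subst hvw
      simp
      positivity
    · simp only [hvw, if_false, zero_add]
      rw [le_div_iff₀ hq0, ← pow_succ, ← pow_add]
      apply pow_le_pow_of_le_one hq0.le hq1
      have := Finset.card_union_add_card_inter (star v) (star w)
      have := star_inter v w hvw
      omega
  have hpt : ∀ ω, M ^ 2 * erWeight n p ω - M ^ 2 * ({ω | ¬ (graphOf ω).Connected} : Set (EConfig n)).indicator (erWeight n p) ω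
      ≤ erWeight n p ω * (X ω) ^ 2 - 2 * M * (erWeight n p ω * X ω) + M ^ 2 * erWeight n p ω := by
    intro ω
    have hw := weight_nonneg h0 h1.le ω
    have hsq : 0 ≤ erWeight n p ω * (X ω - M) ^ 2 := by positivity
    by_cases hc : (graphOf ω).Connected
    · have hX : X ω = 0 := by
        refine Finset.sum_eq_zero fun v _ => ?_
        by_contra hh
        exact not_conn hn ω v hh hc
      simp [hc, hX]
    · simp [hc]
      nlinarith
  have hsum := Finset.sum_le_sum (s := Finset.univ) fun ω _ => hpt ω
  simp only [Finset.sum_sub_distrib, Finset.sum_add_distrib, ← Finset.mul_sum, exp_one, hE1] at hsum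
  change _ - M ^ 2 * erProb n p _ ≤ _ at hsum
  set P := erProb n p {ω | ¬ (graphOf ω).Connected}
  have h3 : M ^ 2 * (1 - P) ≤ M + M ^ 2 * (1 / q - 1) := by
    have : M ^ 2 * (1 / q - 1) = M ^ 2 / q - M ^ 2 := by ring
    nlinarith
  have h4 : 1 - P ≤ 1 / M + p / q := by
    have hp : p / q = 1 / q - 1 := by
      field_simp; linarith
    rw [hp]
    have : M + M ^ 2 * (1 / q - 1) = M ^ 2 * (1 / M + (1 / q - 1)) := by
      field_simp
    rw [this] at h3
    exact le_of_mul_le_mul_left h3 (by positivity)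
  have h5 : 1 / M ≤ 1 / (n * q ^ n) := one_div_le_one_div_of_le hnq hMn
  linarith

theorem analytic (a c : ℝ) (hc0 : 0 < c) (hc1 : c < 1)
    (ha0 : 0 < a) (ha1 : a < 1 - c) (c' : ℝ) (hc' : c' < c) :
    ∀ᶠ n : ℕ in Filter.atTop, 2 ≤ n ∧ 0 ≤ a * Real.log n / n ∧ a * Real.log n / n < 1 ∧
      1 / (n * (1 - a * Real.log n / n) ^ n) + (a * Real.log n / n) / (1 - a * Real.log n / n)
        ≤ (n : ℝ) ^ (-c') := by
  have hr : a / (1 - c) < 1 := by rw [div_lt_one (by linarith)]; exact ha1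
  have t1 : Filter.Tendsto (fun x : ℝ => a * Real.log x / x) Filter.atTop (nhds 0) := by
    have := (Real.isLittleO_log_id_atTop.tendsto_div_nhds_zero).const_mul a
    simpa [mul_div_assoc] using this
  have ev1 := t1.eventually (gt_mem_nhds (show (0 : ℝ) < 1 - a / (1 - c) by linarith))
  have t2 : Filter.Tendsto (fun x : ℝ => x ^ (-(c - c'))) Filter.atTop (nhds 0) :=
    tendsto_rpow_neg_atTop (by linarith)
  have ev2 := t2.eventually (gt_mem_nhds (show (0 : ℝ) < 1 / 2 by norm_num))
  have t3 : Filter.Tendsto (fun x : ℝ => Real.log x / x ^ (1 - c')) Filter.atTop (nhds 0) :=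
    (isLittleO_log_rpow_atTop (by linarith)).tendsto_div_nhds_zero
  have ev3 := t3.eventually (gt_mem_nhds (show (0 : ℝ) < 1 / 2 by norm_num))
  filter_upwards [tendsto_natCast_atTop_atTop.eventually ev1,
    tendsto_natCast_atTop_atTop.eventually ev2, tendsto_natCast_atTop_atTop.eventually ev3,
    Filter.eventually_ge_atTop 2] with n e1 e2 e3 hn
  have hx : (2 : ℝ) ≤ n := by exact_mod_cast hn
  have hx0 : (0 : ℝ) < n := by linarith
  have hlog : 0 ≤ Real.log n := Real.log_nonneg (by linarith)
  set p := a * Real.log n / n with hp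
  have hp0 : 0 ≤ p := by positivity
  have had : 0 < a / (1 - c) := div_pos ha0 (by linarith)
  have hq : a / (1 - c) < 1 - p := by linarith
  have hq0 : 0 < 1 - p := by linarith
  have haq : a / (1 - p) ≤ 1 - c := by
    rw [div_le_iff₀ hq0]
    rw [div_lt_iff₀ (by linarith)] at hq
    linarith
  refine ⟨hn, hp0, by linarith, ?_⟩
  have hexp : Real.exp (-(p / (1 - p))) ≤ 1 - p := by
    have h := Real.add_one_le_exp (p / (1 - p))
    have h' : p / (1 - p) + 1 = (1 - p)⁻¹ := by field_simp; ring
    rw [h'] at h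
    rw [Real.exp_neg]
    exact inv_le_of_inv_le₀ hq0 h
  have hmain : (n : ℝ) ^ c ≤ n * (1 - p) ^ n := by
    have h1 : Real.exp (-(p / (1 - p))) ^ n ≤ (1 - p) ^ n :=
      pow_le_pow_left₀ (Real.exp_pos _).le hexp n
    rw [← Real.exp_nat_mul] at h1
    have h2 : (n : ℝ) * (-(p / (1 - p))) = -(a / (1 - p)) * Real.log n := by
      rw [hp]; field_simp
    rw [h2] at h1
    have h3 : -(1 - c) * Real.log n ≤ -(a / (1 - p)) * Real.log n := by nlinarith
    have h4 := (Real.exp_le_exp.mpr h3).trans h1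
    calc (n : ℝ) ^ c = n * Real.exp (-(1 - c) * Real.log n) := by
          rw [Real.rpow_def_of_pos hx0]
          nth_rewrite 2 [← Real.exp_log hx0]
          rw [← Real.exp_add]; congr 1; ring
      _ ≤ _ := by gcongr
  have hA : 1 / (n * (1 - p) ^ n) ≤ (n : ℝ) ^ (-c') * (1 / 2) := by
    calc 1 / (n * (1 - p) ^ n) ≤ 1 / (n : ℝ) ^ c :=
          one_div_le_one_div_of_le (by positivity) hmain
      _ = (n : ℝ) ^ (-c') * (n : ℝ) ^ (-(c - c')) := by
          rw [← Real.rpow_add hx0, one_div, ← Real.rpow_neg hx0.le]; congr 1; ring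
      _ ≤ _ := by gcongr
  have hB : p / (1 - p) ≤ (n : ℝ) ^ (-c') * (1 / 2) := by
    calc p / (1 - p) = (a / (1 - p)) * (Real.log n / n) := by
          rw [hp]; ring
      _ ≤ 1 * (Real.log n / n) := by gcongr; linarith
      _ = (n : ℝ) ^ (-c') * (Real.log n / (n : ℝ) ^ (1 - c')) := by
          rw [Real.rpow_sub hx0, Real.rpow_neg hx0.le, Real.rpow_one]; field_simp
      _ ≤ _ := by gcongr
  linarith

/-- If `0 < a < 1 − c < 1` and `p_n = a·log n/n`, then for every
`0 < c' < c`, for all large `n`, `G(n, p_n)` is disconnected with probability at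
least `1 − n^(−c')`. -/
theorem er_disconnected_whp (a c : ℝ) (hc0 : 0 < c) (hc1 : c < 1)
    (ha0 : 0 < a) (ha1 : a < 1 - c) :
    ∀ c' : ℝ, 0 < c' → c' < c → ∃ N : ℕ, ∀ n : ℕ, N ≤ n →
      1 - (n : ℝ) ^ (-c') ≤
        erProb n (a * Real.log n / n) {ω | ¬ (graphOf ω).Connected} := by
  intro c' _ hc'
  obtain ⟨N, hN⟩ := Filter.eventually_atTop.mp (analytic a c hc0 hc1 ha0 ha1 c' hc')
  refine ⟨N, fun n hn => ?_⟩
  obtain ⟨h2, hp0, hp1, hb⟩ := hN n hn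
  exact le_trans (by linarith) (cheb h2 _ hp0 hp1)

end ErdosRenyi
end

section
/- Let 0 < a < 1 and β > 0 be constants, and set p_n = a·log n/n. Then for every ε > 0 there is N such that for all n ≥ N, the probability that the size Z_n of a largest connected component of G(n, p_n) satisfies Z_n ≤ β·log n is at most n^{−(1−ε)·a·n/2}. -/
/-!
Erdős–Rényi random graphs `G(n,p)`: each of the `C(n,2)` unordered pairs of
distinct vertices is an edge independently with probability `p`.
-/

open scoped BigOperators

namespace ErdosRenyi

lemma greedy_balance {ι : Type*} [DecidableEq ι] (M : ℕ) (hM : 0 < M) (w : ι → ℝ) (k : ℝ)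
    (hw0 : ∀ i, 0 ≤ w i) (hwk : ∀ i, w i ≤ k) (s : Finset ι) :
    ∃ g : ι → Fin M, (M : ℝ) * ∑ i ∈ s, ∑ j ∈ s, (if g i = g j then w i * w j else 0)
      ≤ (∑ i ∈ s, w i) ^ 2 + M * k * ∑ i ∈ s, w i := by
  induction s using Finset.induction_on with
  | empty => exact ⟨fun _ => ⟨0, hM⟩, by simp⟩
  | insert x s hx ih =>
    obtain ⟨g, hg⟩ := ih
    have hMr : (0 : ℝ) < M := by exact_mod_cast hM
    have hc : ∃ c : Fin M, (M : ℝ) * (∑ i ∈ s, if g i = c then w i else 0) ≤ ∑ i ∈ s, w i := by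
      by_contra! hcon
      have h1 : ∑ c : Fin M, (∑ i ∈ s, w i)
          < ∑ c : Fin M, (M : ℝ) * (∑ i ∈ s, if g i = c then w i else 0) :=
        Finset.sum_lt_sum_of_nonempty ⟨⟨0, hM⟩, Finset.mem_univ _⟩ (fun c _ => hcon c)
      have h2 : ∑ c : Fin M, (∑ i ∈ s, if g i = c then w i else 0) = ∑ i ∈ s, w i := by
        rw [Finset.sum_comm]
        simp
      rw [← Finset.mul_sum, h2, Finset.sum_const, Finset.card_univ, Fintype.card_fin,
        nsmul_eq_mul] at h1
      exact lt_irrefl _ h1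
    obtain ⟨c, hc⟩ := hc
    refine ⟨Function.update g x c, ?_⟩
    have hne : ∀ i ∈ s, i ≠ x := fun i hi h => hx (h ▸ hi)
    have e1 : ∑ i ∈ insert x s, ∑ j ∈ insert x s,
        (if Function.update g x c i = Function.update g x c j then w i * w j else 0)
        = w x * w x + 2 * w x * (∑ i ∈ s, if g i = c then w i else 0)
          + ∑ i ∈ s, ∑ j ∈ s, (if g i = g j then w i * w j else 0) := by
      rw [Finset.sum_insert hx, Finset.sum_insert hx]
      have a1 : ∑ j ∈ s, (if Function.update g x c x = Function.update g x c j
          then w x * w j else 0) = w x * (∑ i ∈ s, if g i = c then w i else 0) := by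
        rw [Finset.mul_sum]
        refine Finset.sum_congr rfl fun j hj => ?_
        rw [Function.update_self, Function.update_of_ne (hne j hj)]
        by_cases h : g j = c
        · simp [h]
        · simp [h, Ne.symm h]
      have a2 : ∑ i ∈ s, ∑ j ∈ insert x s,
          (if Function.update g x c i = Function.update g x c j then w i * w j else 0)
          = w x * (∑ i ∈ s, if g i = c then w i else 0)
            + ∑ i ∈ s, ∑ j ∈ s, (if g i = g j then w i * w j else 0) := by
        rw [Finset.mul_sum, ← Finset.sum_add_distrib]
        refine Finset.sum_congr rfl fun i hi => ?_
        rw [Finset.sum_insert hx, Function.update_self, Function.update_of_ne (hne i hi)]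
        congr 1
        · by_cases h : g i = c
          · simp [h, mul_comm]
          · simp [h]
        · refine Finset.sum_congr rfl fun j hj => ?_
          rw [Function.update_of_ne (hne j hj)]
      rw [a1, a2]
      simp only [if_true]
      ring
    rw [e1, Finset.sum_insert hx]
    have h1 := mul_le_mul_of_nonneg_left hc (hw0 x)
    have h2 := mul_le_mul_of_nonneg_left (mul_le_mul_of_nonneg_left (hwk x) (hw0 x)) hMr.le
    nlinarith [sq_nonneg (w x)]

lemma erProb_false (n : ℕ) (p : ℝ) (E : Finset (EPair n)) :
    erProb n p {ω | ∀ e ∈ E, ω e = false} = (1 - p) ^ E.card := by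
  classical
  have h := Finset.prod_univ_sum (fun _ : EPair n => (Finset.univ : Finset Bool))
    (fun e b => if e ∈ E then (if b then 0 else 1 - p) else (if b then p else 1 - p))
  have hL : (∏ e : EPair n, ∑ b ∈ (Finset.univ : Finset Bool),
      (if e ∈ E then (if b then 0 else 1 - p) else (if b then p else 1 - p)))
      = (1 - p) ^ E.card := by
    have : ∀ e : EPair n, (∑ b ∈ (Finset.univ : Finset Bool),
        (if e ∈ E then (if b then 0 else 1 - p) else (if b then p else 1 - p)))
        = if e ∈ E then 1 - p else 1 := by
      intro e
      by_cases he : e ∈ E <;> simp [he]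
    rw [Finset.prod_congr rfl (fun e _ => this e), Finset.prod_ite_mem]
    simp
  rw [← hL, h, Fintype.piFinset_univ]
  unfold erProb
  refine Finset.sum_congr rfl fun ω _ => ?_
  by_cases hω : ∀ e ∈ E, ω e = false
  · rw [Set.indicator_of_mem (by exact hω)]
    refine Finset.prod_congr rfl fun e _ => ?_
    by_cases he : e ∈ E
    · simp [he, hω e he]
    · simp [he]
  · rw [Set.indicator_of_notMem (by exact hω)]
    push Not at hω
    obtain ⟨e, he, hee⟩ := hω
    refine (Finset.prod_eq_zero (Finset.mem_univ e) ?_).symm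
    simp [he, hee]

lemma erWeight_nonneg (n : ℕ) (p : ℝ) (h0 : 0 ≤ p) (h1 : p ≤ 1) (ω : EConfig n) :
    0 ≤ erWeight n p ω := by
  refine Finset.prod_nonneg fun e _ => ?_
  split_ifs <;> linarith

/-- pairs separated by a colouring -/
def crossPairs {n M : ℕ} (f : Fin n → Fin M) : Finset (EPair n) :=
  Finset.univ.filter fun e => f e.1.1 ≠ f e.1.2

lemma card_cross {n M : ℕ} (f : Fin n → Fin M) :
    2 * ((crossPairs f).card : ℝ) + ∑ u, ∑ v, (if f u = f v then (1 : ℝ) else 0) = (n : ℝ) ^ 2 := by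
  have h1 : ((crossPairs f).card : ℝ)
      = ∑ u : Fin n, ∑ v : Fin n, (if u < v ∧ f u ≠ f v then (1 : ℝ) else 0) := by
    rw [← Fintype.sum_prod_type' (f := fun u v : Fin n =>
      (if u < v ∧ f u ≠ f v then (1 : ℝ) else 0)), Finset.sum_boole]
    congr 1
    unfold crossPairs
    refine Finset.card_bij (fun e _ => e.1) ?_ ?_ ?_
    · rintro ⟨e, he⟩ h
      simp at h ⊢
      exact ⟨he, h⟩
    · intro a _ b _ h
      exact Subtype.ext h
    · intro b hb
      simp at hb
      exact ⟨⟨b, hb.1⟩, by simpa using hb.2, rfl⟩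
  have h2 : ∑ u : Fin n, ∑ v : Fin n, (if u < v ∧ f u ≠ f v then (1 : ℝ) else 0)
      = ∑ u : Fin n, ∑ v : Fin n, (if v < u ∧ f v ≠ f u then (1 : ℝ) else 0) := Finset.sum_comm
  have h3 : (n : ℝ) ^ 2 = ∑ u : Fin n, ∑ v : Fin n, (1 : ℝ) := by
    simp [sq]
  have h4 : ∑ u : Fin n, ∑ v : Fin n, (1 : ℝ)
      = ∑ u : Fin n, ∑ v : Fin n, (if u < v ∧ f u ≠ f v then (1 : ℝ) else 0)
        + ∑ u : Fin n, ∑ v : Fin n, (if v < u ∧ f v ≠ f u then (1 : ℝ) else 0)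
        + ∑ u : Fin n, ∑ v : Fin n, (if f u = f v then (1 : ℝ) else 0) := by
    rw [← Finset.sum_add_distrib, ← Finset.sum_add_distrib]
    refine Finset.sum_congr rfl fun u _ => ?_
    rw [← Finset.sum_add_distrib, ← Finset.sum_add_distrib]
    refine Finset.sum_congr rfl fun v _ => ?_
    by_cases h : f u = f v
    · simp [h]
    · have huv : u ≠ v := fun h' => h (congrArg f h')
      rcases lt_or_gt_of_ne huv with h' | h'
      · simp [h, h', not_lt_of_gt h']
      · simp [h, h', not_lt_of_gt h', Ne.symm h]
  rw [h3, h4, ← h2, ← h1]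
  ring

lemma exists_colouring {n M : ℕ} (hM : 0 < M) (H : SimpleGraph (Fin n)) (k : ℝ)
    (hk : (maxCompSize H : ℝ) ≤ k) : ∃ f : Fin n → Fin M,
      (∀ u v, H.Adj u v → f u = f v) ∧
      (M : ℝ) * ∑ u, ∑ v, (if f u = f v then (1 : ℝ) else 0) ≤ (n : ℝ) ^ 2 + M * k * n := by
  classical
  let w : H.ConnectedComponent → ℝ := fun c =>
    ∑ v : Fin n, if H.connectedComponentMk v = c then (1 : ℝ) else 0
  have hw0 : ∀ c, 0 ≤ w c := fun c => Finset.sum_nonneg fun v _ => by split_ifs <;> norm_num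
  have hwk : ∀ c, w c ≤ k := by
    intro c
    induction c using SimpleGraph.ConnectedComponent.ind with
    | _ v =>
    refine le_trans ?_ hk
    have h1 : {x | H.Reachable v x}.ncard ≤ maxCompSize H :=
      Finset.le_sup (f := fun v => {x | H.Reachable v x}.ncard) (Finset.mem_univ v)
    refine le_trans (le_of_eq ?_) (Nat.cast_le.mpr h1)
    simp only [w]
    rw [Finset.sum_boole, ← Set.ncard_coe_finset]
    congr 2
    ext x
    simp [SimpleGraph.reachable_comm]
  obtain ⟨g, hg⟩ := greedy_balance M hM w k hw0 hwk Finset.univ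
  have hs : ∑ c, w c = n := by
    simp only [w]
    rw [Finset.sum_comm]
    simp
  rw [hs] at hg
  refine ⟨fun v => g (H.connectedComponentMk v), ?_, ?_⟩
  · intro u v h
    exact congrArg g (SimpleGraph.ConnectedComponent.sound h.reachable)
  · refine le_trans (le_of_eq ?_) hg
    congr 1
    have key : ∀ F : H.ConnectedComponent → ℝ,
        ∑ c, w c * F c = ∑ v, F (H.connectedComponentMk v) := by
      intro F
      simp only [w, Finset.sum_mul]
      rw [Finset.sum_comm]
      simp
    have e : ∀ c c', (if g c = g c' then w c * w c' else 0)
        = w c * (w c' * if g c = g c' then 1 else 0) := by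
      intro c c'
      split_ifs <;> simp
    simp only [e, ← Finset.mul_sum]
    rw [key]
    refine Finset.sum_congr rfl fun u _ => ?_
    rw [key (fun c' => if g (H.connectedComponentMk u) = g c' then 1 else 0)]

lemma erProb_bound (n M : ℕ) (hM : 0 < M) (p k : ℝ) (h0 : 0 ≤ p) (h1 : p ≤ 1) :
    erProb n p {ω | (maxCompSize (graphOf ω) : ℝ) ≤ k}
      ≤ (M : ℝ) ^ n * Real.exp (-(p * ((n : ℝ) ^ 2 - (n : ℝ) ^ 2 / M - k * n) / 2)) := by
  classical
  have hMr : (0 : ℝ) < M := by exact_mod_cast hM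
  set B := Real.exp (-(p * ((n : ℝ) ^ 2 - (n : ℝ) ^ 2 / M - k * n) / 2)) with hB
  let good : (Fin n → Fin M) → Prop := fun f =>
    (M : ℝ) * ∑ u, ∑ v, (if f u = f v then (1 : ℝ) else 0) ≤ (n : ℝ) ^ 2 + M * k * n
  have hstep : erProb n p {ω | (maxCompSize (graphOf ω) : ℝ) ≤ k}
      ≤ ∑ f : Fin n → Fin M, if good f then
          erProb n p {ω | ∀ e ∈ crossPairs f, ω e = false} else 0 := by
    unfold erProb
    have : ∀ f : Fin n → Fin M, (if good f then
        ∑ ω, ({ω | ∀ e ∈ crossPairs f, ω e = false} : Set (EConfig n)).indicator (erWeight n p) ω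
        else 0) = ∑ ω, if good f then
        ({ω | ∀ e ∈ crossPairs f, ω e = false} : Set (EConfig n)).indicator (erWeight n p) ω
        else 0 := by
      intro f
      split_ifs <;> simp
    rw [Finset.sum_congr rfl (fun f _ => this f), Finset.sum_comm]
    refine Finset.sum_le_sum fun ω _ => ?_
    have hnn : ∀ f : Fin n → Fin M, 0 ≤ (if good f then
        ({ω | ∀ e ∈ crossPairs f, ω e = false} : Set (EConfig n)).indicator (erWeight n p) ω
        else 0) := by
      intro f
      split_ifs
      · exact Set.indicator_nonneg (fun ω _ => erWeight_nonneg n p h0 h1 ω) ω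
      · exact le_rfl
    by_cases hω : (maxCompSize (graphOf ω) : ℝ) ≤ k
    · obtain ⟨f, hf1, hf2⟩ := exists_colouring hM (graphOf ω) k hω
      refine le_trans (le_of_eq ?_) (Finset.single_le_sum (fun f _ => hnn f) (Finset.mem_univ f))
      have hgf : good f := hf2
      rw [if_pos hgf, Set.indicator_of_mem (by exact hω), Set.indicator_of_mem]
      rintro ⟨⟨u, v⟩, huv⟩ he
      simp only [crossPairs, Finset.mem_filter] at he
      by_contra hcon
      refine he.2 (hf1 u v ?_)
      rw [graphOf, SimpleGraph.fromRel_adj]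
      exact ⟨ne_of_lt huv, Or.inl ⟨huv, by simpa using hcon⟩⟩
    · rw [Set.indicator_of_notMem (by exact hω)]
      exact Finset.sum_nonneg fun f _ => hnn f
  refine hstep.trans ?_
  have hterm : ∀ f : Fin n → Fin M, (if good f then
      erProb n p {ω | ∀ e ∈ crossPairs f, ω e = false} else 0) ≤ B := by
    intro f
    split_ifs with hf
    · rw [erProb_false]
      have hc := card_cross f
      have h2 : (1 - p) ^ (crossPairs f).card ≤ Real.exp (-p) ^ (crossPairs f).card :=
        pow_le_pow_left₀ (by linarith) (Real.one_sub_le_exp_neg p) _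
      refine h2.trans ?_
      rw [← Real.exp_nat_mul, hB]
      apply Real.exp_le_exp.mpr
      have hf' : ∑ u, ∑ v, (if f u = f v then (1 : ℝ) else 0) ≤ (n : ℝ) ^ 2 / M + k * n := by
        have : (n : ℝ) ^ 2 / M + k * n = ((n : ℝ) ^ 2 + M * k * n) / M := by
          field_simp
        rw [this, le_div_iff₀ hMr, mul_comm]
        exact hf
      nlinarith
    · exact (Real.exp_pos _).le
  refine (Finset.sum_le_sum fun f _ => hterm f).trans ?_
  simp

/-- For `0 < a < 1`, `p_n = a·log n/n` and a constant `β > 0`,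
for every `ε > 0` there is `N` such that for all `n ≥ N` the largest connected
component of `G(n, p_n)` has size at most `β log n` with probability at most
`n^(−(1−ε)·a·n/2)`. -/
theorem er_no_small_max_component (a β : ℝ) (ha0 : 0 < a) (ha1 : a < 1)
    (hβ : 0 < β) :
    ∀ ε : ℝ, 0 < ε → ∃ N : ℕ, ∀ n : ℕ, N ≤ n →
      erProb n (a * Real.log n / n)
          {ω | (maxCompSize (graphOf ω) : ℝ) ≤ β * Real.log n}
        ≤ (n : ℝ) ^ (-((1 - ε) * a * n / 2)) := by
  intro ε hε
  obtain ⟨M, hMε⟩ := exists_nat_gt (3 / ε)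
  have hMr : (0 : ℝ) < M := lt_trans (by positivity) hMε
  have hM : 0 < M := by exact_mod_cast hMr
  have hMi : 1 / (M : ℝ) ≤ ε / 3 := by
    rw [div_lt_iff₀ hε] at hMε
    rw [div_le_iff₀ hMr]
    linarith
  have hlog : Filter.Tendsto (fun n : ℕ => Real.log (n : ℝ)) Filter.atTop Filter.atTop :=
    Real.tendsto_log_atTop.comp tendsto_natCast_atTop_atTop
  have hlo : (fun n : ℕ => Real.log (n : ℝ)) =o[Filter.atTop] (fun n : ℕ => (n : ℝ)) :=
    Real.isLittleO_log_id_atTop.comp_tendsto tendsto_natCast_atTop_atTop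
  have e1 := hlog.eventually_ge_atTop (6 * Real.log M / (ε * a))
  have e2 := hlo.def (show 0 < ε / (3 * β) by positivity)
  have e4 := Filter.eventually_ge_atTop (α := ℕ) 2
  rw [← Filter.eventually_atTop]
  filter_upwards [e1, e2, e4] with n h1 h2 h4
  have hn : (2 : ℝ) ≤ n := by exact_mod_cast h4
  have hn0 : (0 : ℝ) < n := by linarith
  have hL : 0 < Real.log n := Real.log_pos (by linarith)
  set L := Real.log n with hLdef
  rw [Real.norm_of_nonneg hL.le, Real.norm_of_nonneg hn0.le] at h2
  have hLn : L ≤ n := (Real.log_le_sub_one_of_pos hn0).trans (by linarith)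
  have hp1 : a * L / n ≤ 1 := by
    rw [div_le_one hn0]
    nlinarith
  refine (erProb_bound n M hM (a * L / n) (β * L) (by positivity) hp1).trans ?_
  rw [Real.rpow_def_of_pos hn0, ← hLdef]
  have hMp : (M : ℝ) ^ n = Real.exp (n * Real.log M) := by
    rw [Real.exp_nat_mul, Real.exp_log hMr]
  rw [hMp, ← Real.exp_add]
  apply Real.exp_le_exp.mpr
  have hp : a * L / n * ((n : ℝ) ^ 2 - (n : ℝ) ^ 2 / M - β * L * n) / 2
      = a * L / 2 * (n - n * (1 / M) - β * L) := by
    field_simp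
  rw [hp]
  have k1 : 6 * Real.log M ≤ L * (ε * a) := by
    rwa [div_le_iff₀ (by positivity)] at h1
  have k2 : β * L ≤ ε / 3 * n := by
    have := mul_le_mul_of_nonneg_left h2 hβ.le
    refine this.trans (le_of_eq ?_)
    field_simp
  have k3 := mul_le_mul_of_nonneg_left hMi hn0.le
  have k4 := mul_le_mul_of_nonneg_left k1 hn0.le
  have k5 := mul_le_mul_of_nonneg_left (add_le_add k2 k3) (show 0 ≤ a * L / 2 by positivity)
  nlinarith


end ErdosRenyi
end

section
/- Let M ≥ 1 be an integer and a, b > 0 constants. For even n set p = a·log n/n, q = b·log n/n, and let X_n and Y_n be independent with X_n ~ Binomial(n/2 − ⌈n/(log n)³⌉, p) and Y_n ~ Binomial(n/2, q). Then for every ε > 0 there is N such that for all even n ≥ N: log E[𝟙{X_n > Y_n} · M^{−Y_n}] ≥ (−(a+b)/2 + √(ab/M) − ε) · log n. -/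
/-!
Lemma 5 of the paper: a lower bound on `log E[𝟙{X > Y} · M^(−Y)]` for
independent binomials `X ~ Binom(n/2 − ⌈n/(log n)³⌉, p)` and `Y ~ Binom(n/2, q)`
with `p = a log n / n` and `q = b log n / n`.
-/

open scoped BigOperators

/-- The binomial probability mass function with `N` trials and success
probability `p`. -/
noncomputable def binomPMF (N : ℕ) (p : ℝ) (k : ℕ) : ℝ :=
  (N.choose k : ℝ) * p ^ k * (1 - p) ^ (N - k)


theorem log_factorial_le_aux (m : ℕ) (hm : 1 ≤ m) :
    Real.log (m.factorial : ℝ) ≤ (m + 1) * Real.log m - m + 1 := by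
  induction m, hm using Nat.le_induction with
  | base => simp
  | succ k hk ih =>
    have hk0 : (0 : ℝ) < k := by exact_mod_cast hk
    rw [Nat.factorial_succ, Nat.cast_mul, Real.log_mul (by positivity) (by positivity)]
    have h1 := Real.one_sub_inv_le_log_of_pos (x := ((k : ℝ) + 1) / k) (by positivity)
    rw [Real.log_div (by positivity) (by positivity)] at h1
    have h2 : 1 - (((k : ℝ) + 1) / k)⁻¹ = 1 / (k + 1) := by field_simp; ring
    rw [h2, div_le_iff₀ (by positivity)] at h1
    push_cast
    nlinarith

theorem binom_lower_aux (N m : ℕ) (p : ℝ) (hm : 1 ≤ m) (hmN : m < N) (hp : 0 < p) (hp1 : p < 1) :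
    0 < binomPMF N p m ∧
    m * Real.log (((N : ℝ) - m) * p / m) - Real.log m + m - 1 - p * N / (1 - p)
      ≤ Real.log (binomPMF N p m) := by
  have hq : 0 < 1 - p := by linarith
  have hm0 : (0 : ℝ) < m := by exact_mod_cast hm
  have hNm : (0 : ℝ) < (N : ℝ) - m := by
    have : (m : ℝ) < N := by exact_mod_cast hmN
    linarith
  have hc : (0 : ℝ) < (N.choose m : ℝ) := by exact_mod_cast Nat.choose_pos hmN.le
  refine ⟨by unfold binomPMF; positivity, ?_⟩
  unfold binomPMF
  rw [Real.log_mul (by positivity) (by positivity), Real.log_mul (by positivity) (by positivity),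
    Real.log_pow, Real.log_pow, Real.log_div (by positivity) (by positivity),
    Real.log_mul (by positivity) (by positivity)]
  have hch : ((N : ℝ) - m) ^ m ≤ (m.factorial : ℝ) * N.choose m := by
    have h := Nat.pow_le_choose (α := ℝ) m N
    rw [div_le_iff₀ (by positivity)] at h
    refine le_trans ?_ (h.trans_eq (mul_comm _ _))
    gcongr
    rw [Nat.cast_sub (by omega)]
    push_cast
    linarith
  have hch2 := Real.log_le_log (by positivity) hch
  rw [Real.log_pow, Real.log_mul (by positivity) (by positivity)] at hch2
  have hf := log_factorial_le_aux m hm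
  have hl := Real.one_sub_inv_le_log_of_pos hq
  have hl' : -(p / (1 - p)) ≤ Real.log (1 - p) := by
    have : 1 - (1 - p)⁻¹ = -(p / (1 - p)) := by field_simp; ring
    linarith
  have hnn : 0 ≤ p / (1 - p) := by positivity
  have h3 : -(p * N / (1 - p)) ≤ ((N - m : ℕ) : ℝ) * Real.log (1 - p) := by
    rw [Nat.cast_sub hmN.le]
    have : p * N / (1 - p) = N * (p / (1 - p)) := by ring
    rw [this]
    nlinarith
  nlinarith

open Filter Topology in
theorem binom_asymp_aux (N m : ℕ → ℕ) (c g : ℝ) (hc : 0 < c) (hg : 0 < g)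
    (hN : Tendsto (fun n : ℕ => (N n : ℝ) / n) atTop (𝓝 (1 / 2)))
    (hm : Tendsto (fun n : ℕ => (m n : ℝ) / Real.log n) atTop (𝓝 g)) (ε : ℝ) (hε : 0 < ε) :
    ∀ᶠ n : ℕ in atTop, m n < N n ∧ 0 < c * Real.log n / n ∧ c * Real.log n / n < 1 ∧
      0 < binomPMF (N n) (c * Real.log n / n) (m n) ∧
      (g * Real.log (c / (2 * g)) + g - c / 2 - ε) * Real.log n ≤
        Real.log (binomPMF (N n) (c * Real.log n / n) (m n)) := by
  have hL : Tendsto (fun n : ℕ => Real.log n) atTop atTop :=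
    Real.tendsto_log_atTop.comp tendsto_natCast_atTop_atTop
  have hLn : Tendsto (fun n : ℕ => Real.log n / n) atTop (𝓝 0) := by
    have := Real.isLittleO_log_id_atTop.tendsto_div_nhds_zero
    exact this.comp tendsto_natCast_atTop_atTop
  have hp : Tendsto (fun n : ℕ => c * Real.log n / n) atTop (𝓝 0) := by
    have := hLn.const_mul c
    simpa [mul_div_assoc] using this
  have hmn : Tendsto (fun n : ℕ => (m n : ℝ) / n) atTop (𝓝 0) := by
    have := hm.mul hLn
    rw [mul_zero] at this
    refine this.congr' ?_
    filter_upwards [hL.eventually_gt_atTop 0] with n hn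
    field_simp
  have hmtop : Tendsto (fun n : ℕ => (m n : ℝ)) atTop atTop := by
    have := hm.pos_mul_atTop hg hL
    refine this.congr' ?_
    filter_upwards [hL.eventually_gt_atTop 0] with n hn
    field_simp
  have hlogm : Tendsto (fun n : ℕ => Real.log (m n) / Real.log n) atTop (𝓝 0) := by
    have h1 := (Real.isLittleO_log_id_atTop.tendsto_div_nhds_zero.comp hmtop).mul hm
    rw [zero_mul] at h1
    refine h1.congr' ?_
    filter_upwards [hL.eventually_gt_atTop 0, hmtop.eventually_gt_atTop 0] with n hn hn2
    simp only [Function.comp, id]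
    field_simp
  have hinv : Tendsto (fun n : ℕ => 1 / Real.log n) atTop (𝓝 0) := by
    simp only [one_div]
    exact hL.inv_tendsto_atTop
  have hratio : Tendsto (fun n : ℕ => ((N n : ℝ) / n - (m n : ℝ) / n) * c / ((m n : ℝ) / Real.log n))
      atTop (𝓝 ((1 / 2 - 0) * c / g)) := ((hN.sub hmn).mul_const c).div hm hg.ne'
  have hlr := hratio.log (by positivity)
  have hT : Tendsto (fun n : ℕ => (m n : ℝ) / Real.log n *
      Real.log (((N n : ℝ) / n - (m n : ℝ) / n) * c / ((m n : ℝ) / Real.log n))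
      - Real.log (m n) / Real.log n + (m n : ℝ) / Real.log n - 1 / Real.log n
      - c * ((N n : ℝ) / n) / (1 - c * Real.log n / n)) atTop
      (𝓝 (g * Real.log ((1 / 2 - 0) * c / g) - 0 + g - 0 - c * (1 / 2) / (1 - 0))) :=
    ((((hm.mul hlr).sub hlogm).add hm).sub hinv).sub
      ((hN.const_mul c).div (tendsto_const_nhds.sub hp) (by norm_num))
  have hlim : g * Real.log ((1 / 2 - 0) * c / g) - 0 + g - 0 - c * (1 / 2) / (1 - 0)
      = g * Real.log (c / (2 * g)) + g - c / 2 := by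
    have : (1 / 2 - 0) * c / g = c / (2 * g) := by field_simp; ring
    rw [this]; ring
  rw [hlim] at hT
  have hlt : ∀ᶠ n : ℕ in atTop, (m n : ℝ) / n < 1 / 4 := hmn.eventually_lt_const (by norm_num)
  have hgt : ∀ᶠ n : ℕ in atTop, 1 / 4 < (N n : ℝ) / n := hN.eventually_const_lt (by norm_num)
  filter_upwards [hlt, hgt, hL.eventually_gt_atTop 0, hmtop.eventually_gt_atTop 0,
    eventually_gt_atTop 0, hp.eventually_lt_const one_pos,
    hT.eventually_const_lt (sub_lt_self _ hε)] with n h1 h2 h3 h4 h5 h6 h7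
  have hn : (0 : ℝ) < n := by exact_mod_cast h5
  have hmN : m n < N n := by
    have := (div_lt_div_iff_of_pos_right hn).1 (h1.trans h2)
    exact_mod_cast this
  have hm1 : 1 ≤ m n := by exact_mod_cast h4
  have hpp : 0 < c * Real.log n / n := by positivity
  obtain ⟨q1, q2⟩ := binom_lower_aux (N n) (m n) _ hm1 hmN hpp h6
  refine ⟨hmN, hpp, h6, q1, le_trans ?_ q2⟩
  refine (mul_le_mul_of_nonneg_right h7.le h3.le).trans (le_of_eq ?_)
  have e1 : ((N n : ℝ) / n - (m n : ℝ) / n) * c / ((m n : ℝ) / Real.log n)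
      = ((N n : ℝ) - m n) * (c * Real.log n / n) / m n := by
    field_simp
  rw [e1]
  have h8 : 1 - c * Real.log n / n ≠ 0 := by linarith
  generalize Real.log (((N n : ℝ) - m n) * (c * Real.log n / n) / m n) = A
  generalize hQ : 1 - c * Real.log n / n = Q at *
  field_simp

open Filter Topology in
theorem N1_aux : Tendsto (fun n : ℕ => ((n / 2 : ℕ) : ℝ) / n) atTop (𝓝 (1 / 2)) := by
  have h := (tendsto_nat_floor_mul_div_atTop (R := ℝ) (a := 1 / 2) (by norm_num)).comp
    tendsto_natCast_atTop_atTop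
  refine h.congr fun n => ?_
  simp only [Function.comp]
  congr 2
  rw [← Nat.floor_div_eq_div (K := ℝ)]
  congr 1
  push_cast
  ring

open Filter Topology in
theorem N2_aux : Tendsto (fun n : ℕ => ((n / 2 - ⌈(n : ℝ) / (Real.log n) ^ 3⌉₊ : ℕ) : ℝ) / n)
    atTop (𝓝 (1 / 2)) := by
  have hL : Tendsto (fun n : ℕ => Real.log n) atTop atTop :=
    Real.tendsto_log_atTop.comp tendsto_natCast_atTop_atTop
  have h3 : Tendsto (fun n : ℕ => (Real.log n ^ 3)⁻¹ + (n : ℝ)⁻¹) atTop (𝓝 (0 + 0)) :=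
    (((tendsto_pow_atTop (by norm_num)).comp hL).inv_tendsto_atTop).add
      tendsto_natCast_atTop_atTop.inv_tendsto_atTop
  rw [add_zero] at h3
  have hc : Tendsto (fun n : ℕ => (⌈(n : ℝ) / (Real.log n) ^ 3⌉₊ : ℝ) / n) atTop (𝓝 0) := by
    refine squeeze_zero' (Eventually.of_forall fun n => by positivity) ?_ h3
    filter_upwards [eventually_gt_atTop 0, hL.eventually_gt_atTop 0] with n hn hl
    have hn' : (0 : ℝ) < n := by exact_mod_cast hn
    have := (Nat.ceil_lt_add_one (a := (n : ℝ) / (Real.log n) ^ 3) (by positivity)).le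
    rw [div_le_iff₀ hn']
    refine this.trans (le_of_eq ?_)
    field_simp
  have := N1_aux.sub hc
  rw [sub_zero] at this
  refine this.congr' ?_
  filter_upwards [hc.eventually_lt_const (show (0 : ℝ) < 1 / 4 by norm_num),
    N1_aux.eventually_const_lt (show (1 / 4 : ℝ) < 1 / 2 by norm_num),
    eventually_gt_atTop 0] with n h1 h2 hn
  have hn' : (0 : ℝ) < n := by exact_mod_cast hn
  have hle : ⌈(n : ℝ) / (Real.log n) ^ 3⌉₊ ≤ n / 2 := by
    have := (div_lt_div_iff_of_pos_right hn').1 (h1.trans h2)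
    exact_mod_cast this.le
  rw [Nat.cast_sub hle, sub_div]

theorem binomPMF_nonneg_aux (N : ℕ) (p : ℝ) (k : ℕ) (h0 : 0 ≤ p) (h1 : p ≤ 1) :
    0 ≤ binomPMF N p k := by
  have : 0 ≤ 1 - p := by linarith
  unfold binomPMF
  positivity

/-- For every `ε > 0` and all large even `n`,
`log E[𝟙{X_n > Y_n} · M^(−Y_n)] ≥ (−(a+b)/2 + √(ab/M) − ε) · log n`,
the expectation being the explicit double sum over the joint law of the
independent pair `(X_n, Y_n)`. -/
theorem log_expectation_lower_bound'
    (M : ℕ) (hM : 1 ≤ M) (a b : ℝ) (ha : 0 < a) (hb : 0 < b) :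
    ∀ ε : ℝ, 0 < ε → ∃ N : ℕ, ∀ n : ℕ, N ≤ n → Even n →
      (-(a + b) / 2 + Real.sqrt (a * b / M) - ε) * Real.log n ≤
        Real.log
          (∑ j ∈ Finset.range (n / 2 - ⌈(n : ℝ) / (Real.log n) ^ 3⌉₊ + 1),
            ∑ k ∈ Finset.range (n / 2 + 1),
              binomPMF (n / 2 - ⌈(n : ℝ) / (Real.log n) ^ 3⌉₊)
                  (a * Real.log n / n) j *
                binomPMF (n / 2) (b * Real.log n / n) k *
                (if k < j then (M : ℝ) ^ (-(k : ℤ)) else 0)) := by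
  intro ε hε
  have hM0 : (0 : ℝ) < M := by exact_mod_cast hM
  have hs : 0 < Real.sqrt (a * b / M) := Real.sqrt_pos.2 (by positivity)
  have hsq : Real.sqrt (a * b / M) ^ 2 = a * b / M := Real.sq_sqrt (by positivity)
  obtain ⟨g, hgdef⟩ : ∃ g, g = Real.sqrt (a * b / M) / 2 := ⟨_, rfl⟩
  have hg : 0 < g := by rw [hgdef]; positivity
  have hs2 : Real.sqrt (a * b / M) = 2 * g := by rw [hgdef]; ring
  rw [hs2] at hsq ⊢
  have hL : Filter.Tendsto (fun n : ℕ => Real.log n) Filter.atTop Filter.atTop :=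
    Real.tendsto_log_atTop.comp tendsto_natCast_atTop_atTop
  have hk : Filter.Tendsto (fun n : ℕ => ((⌊g * Real.log n⌋₊ : ℕ) : ℝ) / Real.log n)
      Filter.atTop (nhds g) :=
    (tendsto_nat_floor_mul_div_atTop (R := ℝ) hg.le).comp hL
  have hk1 : Filter.Tendsto (fun n : ℕ => ((⌊g * Real.log n⌋₊ + 1 : ℕ) : ℝ) / Real.log n)
      Filter.atTop (nhds g) := by
    have := hk.add hL.inv_tendsto_atTop
    rw [add_zero] at this
    refine this.congr fun n => ?_
    simp only [Pi.inv_apply]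
    push_cast
    ring
  have hA := binom_asymp_aux _ _ a g ha hg N2_aux hk1 (ε / 2) (by positivity)
  have hB := binom_asymp_aux _ _ b g hb hg N1_aux hk (ε / 2) (by positivity)
  obtain ⟨N, hN⟩ := Filter.eventually_atTop.1 ((hA.and hB).and (hL.eventually_gt_atTop 0))
  refine ⟨N, fun n hn _ => ?_⟩
  obtain ⟨⟨⟨a1, a2, a3, a4, a5⟩, b1, b2, b3, b4, b5⟩, hl⟩ := hN n hn
  set k := ⌊g * Real.log n⌋₊ with hkdef
  set N2 := n / 2 - ⌈(n : ℝ) / (Real.log n) ^ 3⌉₊ with hN2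
  set p := a * Real.log n / n
  set q := b * Real.log n / n
  have hkle : (k : ℝ) ≤ g * Real.log n := Nat.floor_le (by positivity)
  have hnn : ∀ j k' : ℕ, 0 ≤ binomPMF N2 p j * binomPMF (n / 2) q k' *
      (if k' < j then (M : ℝ) ^ (-(k' : ℤ)) else 0) := by
    intro j k'
    refine mul_nonneg (mul_nonneg (binomPMF_nonneg_aux _ _ _ a2.le a3.le)
      (binomPMF_nonneg_aux _ _ _ b2.le b3.le)) ?_
    split_ifs
    · positivity
    · exact le_rfl
  have hsum : binomPMF N2 p (k + 1) * binomPMF (n / 2) q k * (M : ℝ) ^ (-(k : ℤ)) ≤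
      ∑ j ∈ Finset.range (N2 + 1), ∑ k' ∈ Finset.range (n / 2 + 1),
        binomPMF N2 p j * binomPMF (n / 2) q k' *
          (if k' < j then (M : ℝ) ^ (-(k' : ℤ)) else 0) := by
    have s1 := Finset.single_le_sum (s := Finset.range (N2 + 1))
      (f := fun j => ∑ k' ∈ Finset.range (n / 2 + 1),
        binomPMF N2 p j * binomPMF (n / 2) q k' *
          (if k' < j then (M : ℝ) ^ (-(k' : ℤ)) else 0))
      (fun j _ => Finset.sum_nonneg fun k' _ => hnn j k')
      (Finset.mem_range.2 (show k + 1 < N2 + 1 by omega))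
    have s2 := Finset.single_le_sum (s := Finset.range (n / 2 + 1))
      (f := fun k' => binomPMF N2 p (k + 1) * binomPMF (n / 2) q k' *
          (if k' < k + 1 then (M : ℝ) ^ (-(k' : ℤ)) else 0))
      (fun k' _ => hnn (k + 1) k')
      (Finset.mem_range.2 (show k < n / 2 + 1 by omega))
    refine le_trans ?_ (s2.trans s1)
    simp
  have hMk : (0 : ℝ) < (M : ℝ) ^ (-(k : ℤ)) := by positivity
  refine le_trans ?_ (Real.log_le_log (by positivity) hsum)
  rw [Real.log_mul (by positivity) (by positivity), Real.log_mul (by positivity) (by positivity),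
    Real.log_zpow]
  push_cast
  have hlogM : 0 ≤ Real.log M := Real.log_nonneg (by exact_mod_cast hM)
  have hid : Real.log (a / (2 * g)) + Real.log (b / (2 * g)) = Real.log M := by
    rw [← Real.log_mul (by positivity) (by positivity)]
    congr 1
    have : a / (2 * g) * (b / (2 * g)) = a * b / (2 * g) ^ 2 := by ring
    rw [this, hsq]
    field_simp
  have hkM := mul_le_mul_of_nonneg_right hkle hlogM
  have hfin : (-(a + b) / 2 + 2 * g - ε) * Real.log n =
      (g * Real.log (a / (2 * g)) + g - a / 2 - ε / 2) * Real.log n +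
      (g * Real.log (b / (2 * g)) + g - b / 2 - ε / 2) * Real.log n
      - g * Real.log n * Real.log M := by
    rw [← hid]; ring
  linarith
end
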